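/- Let μ and ν be compactly supported Borel probability measures on ℝ (the distributions of bounded real random variables X and Y). Then sup_{ε>0} liminf_{n→∞} sup_{c∈ℝ} (1/n)·log( μ^{∗n}([nc,∞)) / ν^{∗n}([n(c−ε),∞)) ) = sup_{t ≥ 0} log( ∫ e^{tx} dμ(x) / ∫ e^{tx} dν(x) ), and the same equality holds with limsup_{n→∞} in place of liminf_{n→∞}. Here quotients of probabilities are interpreted with the conventions a/0 := +∞ for a > 0 and 0/0 := 0, and log takes values in [−∞, +∞] with log 0 = −∞ and log(+∞) = +∞. (In random-variable language, μ^{∗n}([nc,∞)) = P[(1/n)∑_{i=1}^n X_i ≥ c] for i.i.d. copies X_i of X, and similarly for Y.) -/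

import Mathlib

open MeasureTheory Filter

/-- The support of a measure: the set of points all of whose open neighbourhoods have
positive measure. -/
def msupport {X : Type*} [TopologicalSpace X] [MeasurableSpace X] (μ : Measure X) : Set X :=
  {x | ∀ U : Set X, IsOpen U → x ∈ U → 0 < μ U}

/-- The `n`-fold convolution power of a measure, where the convolution `Measure.conv` is the
pushforward of the product measure along addition. -/
noncomputable def convpow {X : Type*} [AddMonoid X] [MeasurableSpace X]
    (μ : Measure X) : ℕ → Measure X
  | 0 => Measure.dirac 0
  | n + 1 => Measure.conv (convpow μ n) μ


lemma urld_bdd (μ : Measure ℝ) (h : IsCompact (msupport μ)) :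
    ∃ K : ℝ, 0 < K ∧ ∀ᵐ x ∂μ, x ∈ Set.Icc (-K) K := by
  obtain ⟨K, hK⟩ := h.isBounded.subset_closedBall 0
  refine ⟨max K 1, by positivity, ?_⟩
  have h0 : μ (msupport μ)ᶜ = 0 := by
    refine measure_null_of_locally_null _ fun x hx => ?_
    simp only [msupport, Set.mem_compl_iff, Set.mem_ofPred_eq, not_forall] at hx
    obtain ⟨U, hU, hxU, hU0⟩ := hx
    exact ⟨U, mem_nhdsWithin_of_mem_nhds (hU.mem_nhds hxU), by simpa using hU0⟩
  have : ∀ᵐ x ∂μ, x ∈ msupport μ := h0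
  filter_upwards [this] with x hx
  have := hK hx
  rw [Metric.mem_closedBall, dist_zero_right, Real.norm_eq_abs] at this
  exact abs_le.1 (this.trans (le_max_left _ _))

instance urld_prob (μ : Measure ℝ) [IsProbabilityMeasure μ] (n : ℕ) :
    IsProbabilityMeasure (convpow μ n) := by
  induction n with
  | zero => exact Measure.dirac.isProbabilityMeasure
  | succ n ih => unfold convpow; infer_instance

lemma urld_lint (μ : Measure ℝ) [IsProbabilityMeasure μ] (n : ℕ) (t : ℝ) :
    ∫⁻ x, ENNReal.ofReal (Real.exp (t * x)) ∂(convpow μ n)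
      = (∫⁻ x, ENNReal.ofReal (Real.exp (t * x)) ∂μ) ^ n := by
  induction n with
  | zero => simp [convpow]
  | succ n ih =>
    unfold convpow
    rw [Measure.lintegral_conv (by fun_prop)]
    simp_rw [mul_add, Real.exp_add, ENNReal.ofReal_mul (Real.exp_pos _).le]
    simp_rw [lintegral_const_mul' _ _ ENNReal.ofReal_ne_top]
    rw [lintegral_mul_const _ (by fun_prop), ih, pow_succ]

lemma urld_int (μ : Measure ℝ) [IsProbabilityMeasure μ] {K : ℝ}
    (hK : ∀ᵐ x ∂μ, x ∈ Set.Icc (-K) K) (t : ℝ) :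
    Integrable (fun x => Real.exp (t * x)) μ :=
  ProbabilityTheory.integrable_exp_mul_of_mem_Icc (X := id) aemeasurable_id hK

lemma urld_lint_eq (μ : Measure ℝ) [IsProbabilityMeasure μ] {K : ℝ}
    (hK : ∀ᵐ x ∂μ, x ∈ Set.Icc (-K) K) (t : ℝ) :
    ∫⁻ x, ENNReal.ofReal (Real.exp (t * x)) ∂μ
      = ENNReal.ofReal (ProbabilityTheory.mgf id μ t) := by
  exact (ofReal_integral_eq_lintegral_ofReal (urld_int μ hK t)
    (Eventually.of_forall fun x => (Real.exp_pos _).le)).symm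

lemma urld_mgf_pos (μ : Measure ℝ) [IsProbabilityMeasure μ] {K : ℝ}
    (hK : ∀ᵐ x ∂μ, x ∈ Set.Icc (-K) K) (t : ℝ) :
    0 < ProbabilityTheory.mgf id μ t :=
  ProbabilityTheory.mgf_pos (urld_int μ hK t)

lemma urld_intn (μ : Measure ℝ) [IsProbabilityMeasure μ] {K : ℝ}
    (hK : ∀ᵐ x ∂μ, x ∈ Set.Icc (-K) K) (n : ℕ) (t : ℝ) :
    Integrable (fun x => Real.exp (t * x)) (convpow μ n) := by
  refine ⟨by fun_prop, ?_⟩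
  rw [hasFiniteIntegral_iff_ofReal (Eventually.of_forall fun x => (Real.exp_pos _).le),
    urld_lint, urld_lint_eq μ hK]
  exact ENNReal.pow_lt_top ENNReal.ofReal_lt_top

lemma urld_mgfn (μ : Measure ℝ) [IsProbabilityMeasure μ] {K : ℝ}
    (hK : ∀ᵐ x ∂μ, x ∈ Set.Icc (-K) K) (n : ℕ) (t : ℝ) :
    ∫ x, Real.exp (t * x) ∂(convpow μ n) = ProbabilityTheory.mgf id μ t ^ n := by
  rw [integral_eq_lintegral_of_nonneg_ae (Eventually.of_forall fun x => (Real.exp_pos _).le)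
    (by fun_prop), urld_lint, urld_lint_eq μ hK, ENNReal.toReal_pow,
    ENNReal.toReal_ofReal (urld_mgf_pos μ hK t).le]

/-- Chernoff upper bound. -/
lemma urld_chern (μ : Measure ℝ) [IsProbabilityMeasure μ] {K : ℝ}
    (hK : ∀ᵐ x ∂μ, x ∈ Set.Icc (-K) K) (n : ℕ) {t : ℝ} (ht : 0 ≤ t) (a : ℝ) :
    (convpow μ n).real (Set.Ici a) ≤ Real.exp (-t * a) * ProbabilityTheory.mgf id μ t ^ n := by
  have := ProbabilityTheory.measure_ge_le_exp_mul_mgf (X := id) (μ := convpow μ n) a ht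
    (urld_intn μ hK n t)
  have h2 : ProbabilityTheory.mgf id (convpow μ n) t = ProbabilityTheory.mgf id μ t ^ n :=
    urld_mgfn μ hK n t
  rw [h2] at this
  exact this

lemma urld_Iio (ν : Measure ℝ) [IsProbabilityMeasure ν] {K : ℝ}
    (hK : ∀ᵐ x ∂ν, x ∈ Set.Icc (-K) K) (n : ℕ) {h : ℝ} (hh : 0 ≤ h) (a : ℝ) :
    1 ≤ Real.exp (h * a) * ProbabilityTheory.mgf id ν (-h) ^ n
      + (convpow ν n).real (Set.Ici a) := by
  have hi : Integrable (fun x => Real.exp (h * a) * Real.exp (-h * x)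
      + (Set.Ici a).indicator 1 x) (convpow ν n) :=
    ((urld_intn ν hK n (-h)).const_mul _).add
      ((integrable_const (1 : ℝ)).indicator measurableSet_Ici)
  have := integral_mono (μ := convpow ν n) (integrable_const (1 : ℝ)) hi (fun x => by
    simp only
    by_cases hx : x ∈ Set.Ici a
    · rw [Set.indicator_of_mem hx]
      have := Real.exp_pos (h * a)
      have := Real.exp_pos (-h * x)
      simp only [Pi.one_apply]
      nlinarith [mul_pos (Real.exp_pos (h * a)) (Real.exp_pos (-h * x))]
    · rw [Set.indicator_of_notMem hx, add_zero, ← Real.exp_add]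
      simp only [Set.mem_Ici, not_le] at hx
      apply Real.one_le_exp
      nlinarith)
  have i3 : Integrable ((Set.Ici a).indicator (1 : ℝ → ℝ)) (convpow ν n) :=
    (integrable_const (1 : ℝ)).indicator measurableSet_Ici
  rw [integral_add ((urld_intn ν hK n (-h)).const_mul _) i3, integral_const_mul,
      urld_mgfn ν hK, integral_indicator_one measurableSet_Ici] at this
  simpa using this

lemma urld_tilt (ν : Measure ℝ) [IsProbabilityMeasure ν] {K : ℝ}
    (hK : ∀ᵐ x ∂ν, x ∈ Set.Icc (-K) K) (n : ℕ) {t h h' : ℝ} (ht : 0 ≤ t) (hh : 0 ≤ h)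
    (hh' : 0 ≤ h') (a b : ℝ) :
    ProbabilityTheory.mgf id ν t ^ n ≤
      Real.exp (h * a) * ProbabilityTheory.mgf id ν (t - h) ^ n
      + Real.exp (-h' * b) * ProbabilityTheory.mgf id ν (t + h') ^ n
      + Real.exp (t * b) * (convpow ν n).real (Set.Ici a) := by
  have i1 := (urld_intn ν hK n (t - h)).const_mul (Real.exp (h * a))
  have i2 := (urld_intn ν hK n (t + h')).const_mul (Real.exp (-h' * b))
  have i3 : Integrable (fun x => Real.exp (t * b) * (Set.Ici a).indicator 1 x) (convpow ν n) :=
    ((integrable_const (1 : ℝ)).indicator measurableSet_Ici).const_mul _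
  have := integral_mono (μ := convpow ν n) (urld_intn ν hK n t) ((i1.add i2).add i3) (fun x => by
    simp only [Pi.add_apply]
    have e1 : 0 < Real.exp (h * a) * Real.exp ((t - h) * x) := by positivity
    have e2 : 0 < Real.exp (-h' * b) * Real.exp ((t + h') * x) := by positivity
    by_cases hx : x ∈ Set.Ici a
    · rw [Set.indicator_of_mem hx]
      simp only [Pi.one_apply, mul_one]
      rcases le_total x b with hb | hb
      · have : Real.exp (t * x) ≤ Real.exp (t * b) := by
          apply Real.exp_le_exp.2; nlinarith
        linarith
      · have : Real.exp (t * x) ≤ Real.exp (-h' * b) * Real.exp ((t + h') * x) := by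
          rw [← Real.exp_add]
          apply Real.exp_le_exp.2; nlinarith
        linarith [Real.exp_pos (t * b)]
    · rw [Set.indicator_of_notMem hx, mul_zero, add_zero]
      simp only [Set.mem_Ici, not_le] at hx
      have : Real.exp (t * x) ≤ Real.exp (h * a) * Real.exp ((t - h) * x) := by
        rw [← Real.exp_add]
        apply Real.exp_le_exp.2; nlinarith
      linarith)
  rw [urld_mgfn ν hK] at this
  refine this.trans (le_of_eq ?_)
  rw [integral_add' (i1.add i2) i3, integral_add' i1 i2, integral_const_mul, integral_const_mul,
      integral_const_mul, urld_mgfn ν hK, urld_mgfn ν hK, integral_indicator_one measurableSet_Ici]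

lemma urld_slope {f : ℝ → ℝ} {f' x : ℝ} (hf : HasDerivAt f f' x) (hf' : f' < 0) :
    ∃ h : ℝ, 0 < h ∧ f (x + h) < f x := by
  have h1 := (hasDerivAt_iff_tendsto_slope_zero.1 hf).eventually_lt_const hf'
  have h2 : ∀ᶠ t in nhdsWithin (0 : ℝ) (Set.Ioi 0), t⁻¹ • (f (x + t) - f x) < 0 :=
    h1.filter_mono (nhdsWithin_mono _ (fun y hy => ne_of_gt hy))
  obtain ⟨h, hh, hpos⟩ := (h2.and self_mem_nhdsWithin).exists
  have hpos : 0 < h := hpos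
  refine ⟨h, hpos, ?_⟩
  rw [smul_eq_mul] at hh
  by_contra hcon
  have : 0 ≤ h⁻¹ * (f (x + h) - f x) := mul_nonneg (by positivity) (by linarith)
  linarith

lemma urld_analytic (ν : Measure ℝ) [IsProbabilityMeasure ν] {K : ℝ}
    (hK : ∀ᵐ x ∂ν, x ∈ Set.Icc (-K) K) (t : ℝ) :
    AnalyticAt ℝ (ProbabilityTheory.cgf id ν) t := by
  apply ProbabilityTheory.analyticAt_cgf
  have : ProbabilityTheory.integrableExpSet id ν = Set.univ := by
    ext s
    simpa [ProbabilityTheory.integrableExpSet] using urld_int ν hK s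
  simp [this]

lemma urld_exp_cgf (ν : Measure ℝ) [IsProbabilityMeasure ν] {K : ℝ}
    (hK : ∀ᵐ x ∂ν, x ∈ Set.Icc (-K) K) (t : ℝ) :
    Real.exp (ProbabilityTheory.cgf id ν t) = ProbabilityTheory.mgf id ν t :=
  Real.exp_log (urld_mgf_pos ν hK t)

lemma urld_left (ν : Measure ℝ) [IsProbabilityMeasure ν] {K : ℝ}
    (hK : ∀ᵐ x ∂ν, x ∈ Set.Icc (-K) K) {t a : ℝ}
    (h : a < deriv (ProbabilityTheory.cgf id ν) t) :
    ∃ h : ℝ, 0 < h ∧ Real.exp (h * a) * ProbabilityTheory.mgf id ν (t - h)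
      < ProbabilityTheory.mgf id ν t := by
  have hd := (urld_analytic ν hK t).differentiableAt.hasDerivAt
  have hd' : HasDerivAt (fun s : ℝ => s * a + ProbabilityTheory.cgf id ν (t - s))
      (1 * a + -deriv (ProbabilityTheory.cgf id ν) t) 0 := by
    refine ((hasDerivAt_id (0 : ℝ)).mul_const a).add ?_
    have h2 : HasDerivAt (ProbabilityTheory.cgf id ν)
      (deriv (ProbabilityTheory.cgf id ν) t) (t - 0) := by simpa using hd
    exact h2.comp_const_sub t 0
  obtain ⟨s, hs, hlt⟩ := urld_slope hd' (by linarith)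
  refine ⟨s, hs, ?_⟩
  simp only [zero_add, zero_mul, sub_zero] at hlt
  rw [← urld_exp_cgf ν hK, ← urld_exp_cgf ν hK, ← Real.exp_add]
  exact Real.exp_lt_exp.2 hlt

lemma urld_right (ν : Measure ℝ) [IsProbabilityMeasure ν] {K : ℝ}
    (hK : ∀ᵐ x ∂ν, x ∈ Set.Icc (-K) K) {t a : ℝ}
    (h : deriv (ProbabilityTheory.cgf id ν) t < a) :
    ∃ h : ℝ, 0 < h ∧ Real.exp (-h * a) * ProbabilityTheory.mgf id ν (t + h)
      < ProbabilityTheory.mgf id ν t := by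
  have hd := (urld_analytic ν hK t).differentiableAt.hasDerivAt
  have hd' : HasDerivAt (fun s : ℝ => s * (-a) + ProbabilityTheory.cgf id ν (t + s))
      (1 * (-a) + deriv (ProbabilityTheory.cgf id ν) t) 0 := by
    refine ((hasDerivAt_id (0 : ℝ)).mul_const (-a)).add ?_
    have h2 : HasDerivAt (ProbabilityTheory.cgf id ν)
      (deriv (ProbabilityTheory.cgf id ν) t) (t + 0) := by simpa using hd
    exact h2.comp_const_add t 0
  obtain ⟨s, hs, hlt⟩ := urld_slope hd' (by linarith)
  refine ⟨s, hs, ?_⟩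
  simp only [zero_add, zero_mul, add_zero] at hlt
  rw [← urld_exp_cgf ν hK, ← urld_exp_cgf ν hK, ← Real.exp_add]
  refine Real.exp_lt_exp.2 (lt_of_eq_of_lt ?_ hlt)
  ring

lemma urld_pow {A N : ℝ} (hA : 0 ≤ A) (h : A < N) : ∀ᶠ n : ℕ in atTop, A ^ n ≤ N ^ n / 4 := by
  have hN : 0 < N := hA.trans_lt h
  have h1 := (tendsto_pow_atTop_nhds_zero_of_lt_one (div_nonneg hA hN.le)
    ((div_lt_one hN).2 h)).eventually_le_const (show (0 : ℝ) < 1 / 4 by norm_num)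
  filter_upwards [h1] with n hn
  rw [div_pow, div_le_iff₀ (by positivity)] at hn
  linarith

/-- Cramér lower bound, in the form that is needed. -/
lemma urld_cramer (ν : Measure ℝ) [IsProbabilityMeasure ν] {K : ℝ}
    (hK : ∀ᵐ x ∂ν, x ∈ Set.Icc (-K) K) {c ε : ℝ} (hε : 0 < ε) :
    (∃ t : ℝ, 0 ≤ t ∧ ∀ᶠ n : ℕ in atTop,
      ProbabilityTheory.mgf id ν t ^ n * Real.exp (-t * (n * c))
        ≤ 2 * (convpow ν n).real (Set.Ici (n * (c - ε)))) ∨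
    ∀ t : ℝ, 0 ≤ t → ProbabilityTheory.mgf id ν t ≤ Real.exp (t * (c - ε)) := by
  set D := deriv (ProbabilityTheory.cgf id ν) with hD
  have hDc : Continuous D := continuous_iff_continuousAt.2 fun t =>
    (urld_analytic ν hK t).deriv.continuousAt
  by_cases h0 : c ≤ D 0
  · left
    refine ⟨0, le_rfl, ?_⟩
    obtain ⟨h, hh, hlt⟩ := urld_left ν hK (t := 0) (a := c - ε) (by linarith)
    filter_upwards [urld_pow (mul_nonneg (Real.exp_pos _).le (urld_mgf_pos ν hK _).le) hlt]
      with n hn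
    have := urld_Iio ν hK n hh.le (n * (c - ε))
    rw [mul_pow, ← Real.exp_nat_mul, show (n : ℝ) * (h * (c - ε)) = h * (n * (c - ε)) by ring,
      zero_sub] at hn
    simp only [ProbabilityTheory.mgf_zero, one_pow, neg_zero, zero_mul,
      Real.exp_zero, mul_one] at hn ⊢
    linarith
  push Not at h0
  by_cases h1 : ∃ t, 0 ≤ t ∧ c - ε < D t
  · left
    obtain ⟨t, ht, h2, h3⟩ : ∃ t, 0 ≤ t ∧ c - ε < D t ∧ D t < c := by
      obtain ⟨t, ht, h2⟩ := h1
      rcases lt_or_ge (D t) c with h3 | h3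
      · exact ⟨t, ht, h2, h3⟩
      rcases lt_or_ge (c - ε) (D 0) with h4 | h4
      · exact ⟨0, le_rfl, h4, h0⟩
      obtain ⟨s, hs, hs'⟩ := intermediate_value_Icc ht hDc.continuousOn
        (show c - ε / 2 ∈ Set.Icc (D 0) (D t) from ⟨by linarith, by linarith⟩)
      exact ⟨s, hs.1, by rw [hs']; linarith, by rw [hs']; linarith⟩
    refine ⟨t, ht, ?_⟩
    obtain ⟨h, hh, hlt⟩ := urld_left ν hK h2
    obtain ⟨h', hh', hlt'⟩ := urld_right ν hK h3
    filter_upwards [urld_pow (mul_nonneg (Real.exp_pos _).le (urld_mgf_pos ν hK _).le) hlt,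
      urld_pow (mul_nonneg (Real.exp_pos _).le (urld_mgf_pos ν hK _).le) hlt'] with n hn hn'
    have := urld_tilt ν hK n ht hh.le hh'.le (n * (c - ε)) (n * c)
    rw [mul_pow, ← Real.exp_nat_mul, show (n : ℝ) * (h * (c - ε)) = h * (n * (c - ε)) by ring] at hn
    rw [mul_pow, ← Real.exp_nat_mul, show (n : ℝ) * (-h' * c) = -h' * (n * c) by ring] at hn'
    have h5 : ProbabilityTheory.mgf id ν t ^ n
      ≤ 2 * (Real.exp (t * (n * c)) * (convpow ν n).real (Set.Ici (n * (c - ε)))) := by linarith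
    rw [neg_mul, Real.exp_neg, ← div_eq_mul_inv, div_le_iff₀ (Real.exp_pos _)]
    linarith
  · right
    push Not at h1
    intro t ht
    have hdiff : Differentiable ℝ (ProbabilityTheory.cgf id ν) := fun t =>
      (urld_analytic ν hK t).differentiableAt
    have := (convex_Icc 0 t).image_sub_le_mul_sub_of_deriv_le hdiff.continuous.continuousOn
      hdiff.differentiableOn (C := c - ε)
      (fun x hx => h1 x (interior_subset hx).1) 0 ⟨le_rfl, ht⟩ t ⟨ht, le_rfl⟩ ht
    rw [← urld_exp_cgf ν hK]
    apply Real.exp_le_exp.2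
    simp only [ProbabilityTheory.cgf_zero, sub_zero] at this
    linarith

lemma urld_point (μ ν : Measure ℝ) [IsProbabilityMeasure μ] [IsProbabilityMeasure ν] {K K' : ℝ}
    (hμ : ∀ᵐ x ∂μ, x ∈ Set.Icc (-K') K') (hν : ∀ᵐ x ∂ν, x ∈ Set.Icc (-K) K) {R : ℝ}
    (hR : ∀ t, 0 ≤ t → ProbabilityTheory.mgf id μ t
      ≤ Real.exp R * ProbabilityTheory.mgf id ν t) {c ε : ℝ} (hε : 0 < ε) :
    ∀ᶠ n : ℕ in atTop, (convpow μ n).real (Set.Ici (n * c))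
      ≤ 2 * Real.exp R ^ n * (convpow ν n).real (Set.Ici (n * (c - ε))) := by
  rcases urld_cramer ν hν (c := c) hε with ⟨t, ht, hev⟩ | h
  · filter_upwards [hev] with n hn
    calc (convpow μ n).real (Set.Ici (n * c))
        ≤ Real.exp (-t * (n * c)) * ProbabilityTheory.mgf id μ t ^ n := urld_chern μ hμ n ht _
      _ ≤ Real.exp (-t * (n * c)) * (Real.exp R * ProbabilityTheory.mgf id ν t) ^ n := by
          gcongr
          · exact (urld_mgf_pos μ hμ t).le
          · exact hR t ht
      _ = Real.exp R ^ n * (ProbabilityTheory.mgf id ν t ^ n * Real.exp (-t * (n * c))) := by ring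
      _ ≤ Real.exp R ^ n * (2 * (convpow ν n).real (Set.Ici (n * (c - ε)))) := by gcongr
      _ = _ := by ring
  · filter_upwards [eventually_gt_atTop 0] with n hn
    have hn' : (0 : ℝ) < n := by exact_mod_cast hn
    have key : ∀ t : ℝ, 0 ≤ t → (convpow μ n).real (Set.Ici (n * c))
        ≤ Real.exp R ^ n * Real.exp (-(n * ε * t)) := by
      intro t ht
      calc (convpow μ n).real (Set.Ici (n * c))
        ≤ Real.exp (-t * (n * c)) * ProbabilityTheory.mgf id μ t ^ n := urld_chern μ hμ n ht _
      _ ≤ Real.exp (-t * (n * c)) * (Real.exp R * Real.exp (t * (c - ε))) ^ n := by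
          gcongr
          · exact (urld_mgf_pos μ hμ t).le
          · exact (hR t ht).trans (mul_le_mul_of_nonneg_left (h t ht) (Real.exp_pos _).le)
      _ = Real.exp R ^ n * Real.exp (-(n * ε * t)) := by
          rw [mul_pow, ← Real.exp_nat_mul (t * (c - ε)), mul_left_comm, ← Real.exp_add]
          ring_nf
    have hlim : Tendsto (fun t : ℝ => Real.exp R ^ n * Real.exp (-(n * ε * t))) atTop (nhds 0) := by
      have := (Real.tendsto_exp_neg_atTop_nhds_zero.comp
        (tendsto_id.const_mul_atTop (show 0 < (n : ℝ) * ε by positivity))).const_mul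
        (Real.exp R ^ n)
      simpa [Function.comp_def] using this
    have h0 : (convpow μ n).real (Set.Ici (n * c)) ≤ 0 :=
      ge_of_tendsto hlim ((eventually_ge_atTop 0).mono key)
    exact h0.trans (by positivity)

lemma urld_supp (μ : Measure ℝ) [IsProbabilityMeasure μ] {K : ℝ}
    (hK : ∀ᵐ x ∂μ, x ∈ Set.Icc (-K) K) (n : ℕ) :
    ∀ᵐ x ∂(convpow μ n), x ∈ Set.Icc (-(n * K)) (n * K) := by
  induction n with
  | zero => simp [convpow]
  | succ n ih =>
    unfold convpow Measure.conv
    refine (ae_map_iff (p := fun x => x ∈ Set.Icc (-(((n + 1 : ℕ) : ℝ) * K))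
      (((n + 1 : ℕ) : ℝ) * K)) (by fun_prop) measurableSet_Icc).2 ?_
    filter_upwards [Measure.quasiMeasurePreserving_fst.ae ih,
      Measure.quasiMeasurePreserving_snd.ae hK] with p h1 h2
    push_cast
    exact ⟨by linarith [h1.1, h2.1], by linarith [h1.2, h2.2]⟩

lemma urld_unif (μ ν : Measure ℝ) [IsProbabilityMeasure μ] [IsProbabilityMeasure ν] {K : ℝ}
    (hμ : ∀ᵐ x ∂μ, x ∈ Set.Icc (-K) K) (hν : ∀ᵐ x ∂ν, x ∈ Set.Icc (-K) K) {R : ℝ}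
    (hR0 : 0 ≤ R)
    (hR : ∀ t, 0 ≤ t → ProbabilityTheory.mgf id μ t
      ≤ Real.exp R * ProbabilityTheory.mgf id ν t) {ε : ℝ} (hε : 0 < ε) :
    ∀ᶠ n : ℕ in atTop, ∀ c : ℝ, (convpow μ n).real (Set.Ici (n * c))
      ≤ 2 * Real.exp R ^ n * (convpow ν n).real (Set.Ici (n * (c - ε))) := by
  set N := ⌊(2 * K) / (ε / 2)⌋₊
  have hgrid : ∀ᶠ n : ℕ in atTop, ∀ k ∈ Finset.range (N + 1),
      (convpow μ n).real (Set.Ici (n * (-K + k * (ε / 2))))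
      ≤ 2 * Real.exp R ^ n *
        (convpow ν n).real (Set.Ici (n * ((-K + k * (ε / 2)) - ε / 2))) :=
    (eventually_all_finset _).2 fun k _ => urld_point μ ν hμ hν hR (by positivity)
  filter_upwards [hgrid, eventually_gt_atTop 0] with n hn hpos c
  have hn' : (0 : ℝ) < n := by exact_mod_cast hpos
  rcases lt_or_ge c (-K) with h1 | h1
  · have : (convpow ν n).real (Set.Ici (n * (c - ε))) = 1 := by
      rw [measureReal_def, (prob_compl_eq_zero_iff measurableSet_Ici).1, ENNReal.toReal_one]
      change ∀ᵐ x ∂(convpow ν n), x ∈ Set.Ici (n * (c - ε))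
      filter_upwards [urld_supp ν hν n] with x hx
      have : n * (c - ε) ≤ x := by nlinarith [hx.1]
      exact this
    rw [this]
    have h2 : (convpow μ n).real (Set.Ici (n * c)) ≤ 1 := measureReal_le_one
    have h3 : 1 ≤ Real.exp R ^ n := one_le_pow₀ (Real.one_le_exp hR0)
    linarith
  rcases lt_or_ge K c with h2 | h2
  · have : (convpow μ n).real (Set.Ici (n * c)) = 0 := by
      rw [measureReal_eq_zero_iff]
      have h3 : ∀ᵐ x ∂(convpow μ n), ¬ x ∈ Set.Ici (n * c) := by
        filter_upwards [urld_supp μ hμ n] with x hx hx'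
        have : n * c ≤ x := hx'
        nlinarith [hx.2]
      exact measure_eq_zero_iff_ae_notMem.2 h3
    rw [this]
    positivity
  · set k := ⌊(c + K) / (ε / 2)⌋₊ with hk
    have hnn : 0 ≤ (c + K) / (ε / 2) := div_nonneg (by linarith) (by linarith)
    have k1 : (k : ℝ) * (ε / 2) ≤ c + K := by
      rw [← le_div_iff₀ (by positivity)]; exact Nat.floor_le hnn
    have k2 : c + K < (k + 1 : ℝ) * (ε / 2) := by
      rw [← div_lt_iff₀ (by positivity)]; exact Nat.lt_floor_add_one _
    have kN : k ∈ Finset.range (N + 1) := by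
      rw [Finset.mem_range, Nat.lt_succ_iff]
      apply Nat.floor_le_floor
      gcongr
      linarith
    calc (convpow μ n).real (Set.Ici (n * c))
        ≤ (convpow μ n).real (Set.Ici (n * (-K + k * (ε / 2)))) := by
          apply measureReal_mono (Set.Ici_subset_Ici.2 _)
          gcongr; linarith
      _ ≤ _ := hn k kN
      _ ≤ _ := by
          apply mul_le_mul_of_nonneg_left _ (by positivity)
          apply measureReal_mono (Set.Ici_subset_Ici.2 _)
          exact mul_le_mul_of_nonneg_left (by linarith) hn'.le

lemma urld_upper (μ ν : Measure ℝ) [IsProbabilityMeasure μ] [IsProbabilityMeasure ν] {K : ℝ}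
    (hμ : ∀ᵐ x ∂μ, x ∈ Set.Icc (-K) K) (hν : ∀ᵐ x ∂ν, x ∈ Set.Icc (-K) K) {R : ℝ}
    (hR0 : 0 ≤ R)
    (hR : ∀ t, 0 ≤ t → ProbabilityTheory.mgf id μ t
      ≤ Real.exp R * ProbabilityTheory.mgf id ν t) {ε : ℝ} (hε : 0 < ε) :
    limsup (fun n : ℕ =>
        ⨆ c : ℝ, (((n : ℝ)⁻¹ : ℝ) : EReal) *
          ENNReal.log ((convpow μ n) (Set.Ici ((n : ℝ) * c)) /
            (convpow ν n) (Set.Ici ((n : ℝ) * (c - ε))))) atTop ≤ (R : EReal) := by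
  have hlim : Tendsto (fun n : ℕ => ((R + Real.log 2 * (n : ℝ)⁻¹ : ℝ) : EReal)) atTop
      (nhds (R : EReal)) := by
    apply (continuous_coe_real_ereal.tendsto _).comp
    have := (tendsto_inv_atTop_nhds_zero_nat (𝕜 := ℝ)).const_mul (Real.log 2)
    simpa using this.const_add R
  rw [← hlim.limsup_eq]
  apply limsup_le_limsup _ (by isBoundedDefault) (by isBoundedDefault)
  filter_upwards [urld_unif μ ν hμ hν hR0 hR hε, eventually_gt_atTop 0] with n hn hpos
  have hn' : (0 : ℝ) < n := by exact_mod_cast hpos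
  refine iSup_le fun c => ?_
  have h1 : (convpow μ n) (Set.Ici ((n : ℝ) * c)) /
      (convpow ν n) (Set.Ici ((n : ℝ) * (c - ε))) ≤ ENNReal.ofReal (2 * Real.exp R ^ n) := by
    apply ENNReal.div_le_of_le_mul
    have := ENNReal.ofReal_le_ofReal (hn c)
    rwa [ENNReal.ofReal_mul (by positivity), ofReal_measureReal, ofReal_measureReal] at this
  have h2 := ENNReal.log_le_log h1
  rw [ENNReal.log_ofReal_of_pos (by positivity), Real.log_mul (by norm_num) (by positivity),
    Real.log_pow, Real.log_exp] at h2
  have h3 : (0 : EReal) ≤ (((n : ℝ)⁻¹ : ℝ) : EReal) := by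
    exact_mod_cast (inv_pos.2 hn').le
  refine (mul_le_mul_of_nonneg_left h2 h3).trans (le_of_eq ?_)
  rw [← EReal.coe_mul]
  congr 1
  field_simp
  ring

lemma urld_layer (P Q : Measure ℝ) [IsProbabilityMeasure P] [IsProbabilityMeasure Q]
    {C : ENNReal} (hC : C ≠ ⊤) {δ : ℝ} {t : ℝ} (ht : 0 ≤ t)
    (h : ∀ a : ℝ, P (Set.Ici a) ≤ C * Q (Set.Ici (a - δ))) :
    ∫⁻ x, ENNReal.ofReal (Real.exp (t * x)) ∂P ≤
      C * ENNReal.ofReal (Real.exp (t * δ)) * ∫⁻ x, ENNReal.ofReal (Real.exp (t * x)) ∂Q := by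
  rcases ht.eq_or_lt with rfl | ht
  · simp only [zero_mul, Real.exp_zero, ENNReal.ofReal_one, lintegral_const, measure_univ, mul_one]
    have h1 := tendsto_measure_Ici_atBot P
    rw [measure_univ] at h1
    refine le_of_tendsto h1 (Eventually.of_forall fun a => (h a).trans ?_)
    calc C * Q (Set.Ici (a - δ)) ≤ C * 1 := by gcongr; exact prob_le_one
      _ = C := mul_one C
  · have hQ : C * ENNReal.ofReal (Real.exp (t * δ)) *
        ∫⁻ x, ENNReal.ofReal (Real.exp (t * x)) ∂Q
        = C * ∫⁻ x, ENNReal.ofReal (Real.exp (t * (x + δ))) ∂Q := by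
      rw [mul_assoc, ← lintegral_const_mul' _ _ ENNReal.ofReal_ne_top]
      simp_rw [mul_add, Real.exp_add, ENNReal.ofReal_mul (Real.exp_pos _).le]
      congr 2
      ext x
      rw [mul_comm]
    rw [hQ, lintegral_eq_lintegral_meas_le P
        (Eventually.of_forall fun x => (Real.exp_pos _).le) (by fun_prop),
      lintegral_eq_lintegral_meas_le Q
        (Eventually.of_forall fun x => (Real.exp_pos _).le) (by fun_prop),
      ← lintegral_const_mul' _ _ hC]
    refine setLIntegral_mono' measurableSet_Ioi fun s hs => ?_
    have hs : 0 < s := hs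
    have e1 : {x : ℝ | s ≤ Real.exp (t * x)} = Set.Ici (Real.log s / t) := by
      ext x
      simp only [Set.mem_ofPred_eq, Set.mem_Ici]
      rw [div_le_iff₀ ht, ← Real.log_le_iff_le_exp hs, mul_comm]
    have e2 : {x : ℝ | s ≤ Real.exp (t * (x + δ))} = Set.Ici (Real.log s / t - δ) := by
      ext x
      simp only [Set.mem_ofPred_eq, Set.mem_Ici]
      rw [sub_le_iff_le_add, div_le_iff₀ ht, ← Real.log_le_iff_le_exp hs, mul_comm]
    rw [e1, e2]
    exact h _

lemma urld_lower (μ ν : Measure ℝ) [IsProbabilityMeasure μ] [IsProbabilityMeasure ν] {K : ℝ}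
    (hμ : ∀ᵐ x ∂μ, x ∈ Set.Icc (-K) K) (hν : ∀ᵐ x ∂ν, x ∈ Set.Icc (-K) K)
    {t : ℝ} (ht : 0 ≤ t) (ε : ℝ) {n : ℕ} (hpos : 0 < n) :
    ((ProbabilityTheory.cgf id μ t - ProbabilityTheory.cgf id ν t - t * ε : ℝ) : EReal) ≤
        ⨆ c : ℝ, (((n : ℝ)⁻¹ : ℝ) : EReal) *
          ENNReal.log ((convpow μ n) (Set.Ici ((n : ℝ) * c)) /
            (convpow ν n) (Set.Ici ((n : ℝ) * (c - ε)))) := by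
  have hn' : (0 : ℝ) < n := by exact_mod_cast hpos
  by_contra hcon
  rw [not_le] at hcon
  obtain ⟨r, hr1, hr2⟩ := EReal.lt_iff_exists_real_btwn.1 hcon
  have hr2 : r < ProbabilityTheory.cgf id μ t - ProbabilityTheory.cgf id ν t - t * ε := by
    exact_mod_cast hr2
  have key : ∀ c : ℝ, (convpow μ n) (Set.Ici ((n : ℝ) * c)) ≤ ENNReal.ofReal (Real.exp (n * r)) *
      (convpow ν n) (Set.Ici ((n : ℝ) * (c - ε))) := by
    intro c
    have h1 := (le_iSup (fun c : ℝ => (((n : ℝ)⁻¹ : ℝ) : EReal) *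
          ENNReal.log ((convpow μ n) (Set.Ici ((n : ℝ) * c)) /
            (convpow ν n) (Set.Ici ((n : ℝ) * (c - ε))))) c).trans hr1.le
    have h3 : (0 : EReal) ≤ ((n : ℝ) : EReal) := by exact_mod_cast hn'.le
    have h2 := mul_le_mul_of_nonneg_left h1 h3
    rw [← mul_assoc, ← EReal.coe_mul, mul_inv_cancel₀ hn'.ne', EReal.coe_one, one_mul,
      ← EReal.coe_mul, ← Real.log_exp (n * r), ← ENNReal.log_ofReal_of_pos (Real.exp_pos _),
      ENNReal.log_le_log_iff] at h2
    refine (ENNReal.div_le_iff_le_mul ?_ ?_).1 h2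
    · right; exact ENNReal.ofReal_ne_top
    · right; simpa using Real.exp_pos _
  have h4 := urld_layer (convpow μ n) (convpow ν n) (C := ENNReal.ofReal (Real.exp (n * r)))
    ENNReal.ofReal_ne_top (δ := n * ε) ht (fun a => by
      have := key (a / n)
      rwa [mul_sub, mul_div_cancel₀ _ hn'.ne'] at this)
  rw [urld_lint, urld_lint, urld_lint_eq μ hμ, urld_lint_eq ν hν,
    ← urld_exp_cgf μ hμ, ← urld_exp_cgf ν hν, ← ENNReal.ofReal_pow (Real.exp_pos _).le,
    ← ENNReal.ofReal_pow (Real.exp_pos _).le, ← ENNReal.ofReal_mul (Real.exp_pos _).le,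
    ← ENNReal.ofReal_mul (by positivity), ENNReal.ofReal_le_ofReal_iff (by positivity),
    ← Real.exp_nat_mul, ← Real.exp_nat_mul, ← Real.exp_add, ← Real.exp_add,
    Real.exp_le_exp] at h4
  have h5 : (n : ℝ) * ProbabilityTheory.cgf id μ t
    ≤ n * (r + t * ε + ProbabilityTheory.cgf id ν t) := by linarith
  have h6 := le_of_mul_le_mul_left h5 hn'
  linarith

lemma urld_logratio (μ ν : Measure ℝ) [IsProbabilityMeasure μ] [IsProbabilityMeasure ν] {K : ℝ}
    (hμ : ∀ᵐ x ∂μ, x ∈ Set.Icc (-K) K) (hν : ∀ᵐ x ∂ν, x ∈ Set.Icc (-K) K) (t : ℝ) :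
    ENNReal.log ((∫⁻ x, ENNReal.ofReal (Real.exp (t * x)) ∂μ) /
            (∫⁻ x, ENNReal.ofReal (Real.exp (t * x)) ∂ν))
      = ((ProbabilityTheory.cgf id μ t - ProbabilityTheory.cgf id ν t : ℝ) : EReal) := by
  have h1 := urld_mgf_pos μ hμ t
  have h2 := urld_mgf_pos ν hν t
  rw [urld_lint_eq μ hμ, urld_lint_eq ν hν, ← ENNReal.ofReal_div_of_pos h2,
    ENNReal.log_ofReal_of_pos (div_pos h1 h2), Real.log_div h1.ne' h2.ne']
  rfl

/-- The uniform relative large deviation theorem on `ℝ`: the optimal exponential rate at which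
the upper tail probabilities of the random walk generated by `μ` exceed those of the walk
generated by `ν` equals the supremum over `t ≥ 0` of the log-ratio of the moment-generating
functions.  Quotients in `ℝ≥0∞` satisfy `a/0 = ∞` for `a > 0` and `0/0 = 0`, and
`ENNReal.log : ℝ≥0∞ → EReal` satisfies `log 0 = ⊥` and `log ⊤ = ⊤`. -/
theorem uniform_relative_large_deviations_real
    (μ ν : Measure ℝ) [IsProbabilityMeasure μ] [IsProbabilityMeasure ν]
    (hμc : IsCompact (msupport μ)) (hνc : IsCompact (msupport ν)) :
    (⨆ (ε : ℝ) (_ : 0 < ε), liminf (fun n : ℕ =>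
        ⨆ c : ℝ, (((n : ℝ)⁻¹ : ℝ) : EReal) *
          ENNReal.log ((convpow μ n) (Set.Ici ((n : ℝ) * c)) /
            (convpow ν n) (Set.Ici ((n : ℝ) * (c - ε))))) atTop)
      = (⨆ (t : ℝ) (_ : 0 ≤ t),
          ENNReal.log ((∫⁻ x, ENNReal.ofReal (Real.exp (t * x)) ∂μ) /
            (∫⁻ x, ENNReal.ofReal (Real.exp (t * x)) ∂ν))) ∧
    (⨆ (ε : ℝ) (_ : 0 < ε), limsup (fun n : ℕ =>
        ⨆ c : ℝ, (((n : ℝ)⁻¹ : ℝ) : EReal) *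
          ENNReal.log ((convpow μ n) (Set.Ici ((n : ℝ) * c)) /
            (convpow ν n) (Set.Ici ((n : ℝ) * (c - ε))))) atTop)
      = (⨆ (t : ℝ) (_ : 0 ≤ t),
          ENNReal.log ((∫⁻ x, ENNReal.ofReal (Real.exp (t * x)) ∂μ) /
            (∫⁻ x, ENNReal.ofReal (Real.exp (t * x)) ∂ν))) := by
  obtain ⟨K₁, hK₁, hμ₁⟩ := urld_bdd μ hμc
  obtain ⟨K₂, hK₂, hν₂⟩ := urld_bdd ν hνc
  set K := max K₁ K₂
  have hμ : ∀ᵐ x ∂μ, x ∈ Set.Icc (-K) K := hμ₁.mono fun x hx =>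
    ⟨(neg_le_neg (le_max_left _ _)).trans hx.1, hx.2.trans (le_max_left _ _)⟩
  have hν : ∀ᵐ x ∂ν, x ∈ Set.Icc (-K) K := hν₂.mono fun x hx =>
    ⟨(neg_le_neg (le_max_right _ _)).trans hx.1, hx.2.trans (le_max_right _ _)⟩
  simp_rw [urld_logratio μ ν hμ hν]
  set S : EReal := ⨆ (t : ℝ) (_ : 0 ≤ t),
    ((ProbabilityTheory.cgf id μ t - ProbabilityTheory.cgf id ν t : ℝ) : EReal) with hS
  have hSle : ∀ t : ℝ, 0 ≤ t →
      ((ProbabilityTheory.cgf id μ t - ProbabilityTheory.cgf id ν t : ℝ) : EReal) ≤ S :=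
    fun t ht => le_iSup₂_of_le t ht le_rfl
  have hlow : S ≤ (⨆ (ε : ℝ) (_ : 0 < ε), liminf (fun n : ℕ =>
        ⨆ c : ℝ, (((n : ℝ)⁻¹ : ℝ) : EReal) *
          ENNReal.log ((convpow μ n) (Set.Ici ((n : ℝ) * c)) /
            (convpow ν n) (Set.Ici ((n : ℝ) * (c - ε))))) atTop) := by
    refine iSup₂_le fun t ht => ?_
    by_contra hcon
    rw [not_le] at hcon
    obtain ⟨r, hr1, hr2⟩ := EReal.lt_iff_exists_real_btwn.1 hcon
    have hr2 : r < ProbabilityTheory.cgf id μ t - ProbabilityTheory.cgf id ν t := by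
      exact_mod_cast hr2
    set l := ProbabilityTheory.cgf id μ t - ProbabilityTheory.cgf id ν t with hl
    set ε := (l - r) / (t + 1) with hε
    have hεpos : 0 < ε := div_pos (by linarith) (by linarith)
    have h1 : r ≤ l - t * ε := by
      have : (t + 1) * ε = l - r := by rw [hε]; field_simp
      nlinarith
    refine absurd hr1 (not_lt.2 ?_)
    refine le_iSup₂_of_le ε hεpos ?_
    refine le_liminf_of_le (by isBoundedDefault) ?_
    filter_upwards [eventually_gt_atTop 0] with n hn
    refine le_trans ?_ (urld_lower μ ν hμ hν ht ε hn)
    exact_mod_cast h1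
  have hup : (⨆ (ε : ℝ) (_ : 0 < ε), limsup (fun n : ℕ =>
        ⨆ c : ℝ, (((n : ℝ)⁻¹ : ℝ) : EReal) *
          ENNReal.log ((convpow μ n) (Set.Ici ((n : ℝ) * c)) /
            (convpow ν n) (Set.Ici ((n : ℝ) * (c - ε))))) atTop) ≤ S := by
    refine iSup₂_le fun ε hε => ?_
    have hS0 : 0 ≤ S := by simpa using hSle 0 le_rfl
    rcases eq_or_ne S ⊤ with hT | hT
    · rw [hT]; exact le_top
    have hB : S ≠ ⊥ := fun hb => by simp [hb] at hS0
    obtain ⟨R, hR⟩ : ∃ R : ℝ, (R : EReal) = S := ⟨S.toReal, EReal.coe_toReal hT hB⟩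
    rw [← hR]
    rw [← hR] at hS0 hSle
    refine urld_upper μ ν hμ hν (by exact_mod_cast hS0) (fun t ht => ?_) hε
    have := hSle t ht
    rw [EReal.coe_le_coe_iff] at this
    rw [← urld_exp_cgf μ hμ, ← urld_exp_cgf ν hν, ← Real.exp_add]
    apply Real.exp_le_exp.2
    linarith
  have hmid := iSup₂_mono (f := fun (ε : ℝ) (_ : 0 < ε) => liminf (fun n : ℕ =>
        ⨆ c : ℝ, (((n : ℝ)⁻¹ : ℝ) : EReal) *
          ENNReal.log ((convpow μ n) (Set.Ici ((n : ℝ) * c)) /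
            (convpow ν n) (Set.Ici ((n : ℝ) * (c - ε))))) atTop)
      (g := fun (ε : ℝ) (_ : 0 < ε) => limsup (fun n : ℕ =>
        ⨆ c : ℝ, (((n : ℝ)⁻¹ : ℝ) : EReal) *
          ENNReal.log ((convpow μ n) (Set.Ici ((n : ℝ) * c)) /
            (convpow ν n) (Set.Ici ((n : ℝ) * (c - ε))))) atTop)
      (fun ε hε => liminf_le_limsup)
  exact ⟨le_antisymm (hmid.trans hup) hlow, le_antisymm hup (hlow.trans hmid)⟩
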